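/- arXiv:1208.1052 — 2 statements merged into one kernel-verified Lean document; each statement's English description precedes it below -/
import Mathlib

section
/- For all n ≥ 1, all j ≥ 0 and all k ≥ 2, the number a_{n,j}^{(k)} of 231-avoiding permutations σ of {1,…,n} with des(σ) = j and md(σ) ≤ k equals the sum, over all weakly decreasing chains j ≥ i_{k−1} ≥ i_{k−2} ≥ … ≥ i_1 ≥ 0 of nonnegative integers, of the products Π_{m=0}^{k−1} C(i_{m+2} + i_m, 2·i_{m+1}), where by convention i_0 = 0, i_k = j, and i_{k+1} = n. -/
/-- σ avoids the pattern 231: no indices i < j < k with σ k < σ i < σ j. -/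
def avoids231 {n : ℕ} (σ : Equiv.Perm (Fin n)) : Prop :=
  ¬ ∃ i j k : Fin n, i < j ∧ j < k ∧ σ k < σ i ∧ σ i < σ j

/-- The number of descents of σ : positions i with σ i > σ (i+1). -/
noncomputable def des {n : ℕ} (σ : Equiv.Perm (Fin n)) : ℕ :=
  Nat.card {i : Fin n // ∃ h : (i : ℕ) + 1 < n, σ ⟨(i : ℕ) + 1, h⟩ < σ i}

/-- The maximum drop of σ : the maximum of i - σ i. -/
def maxDrop {n : ℕ} (σ : Equiv.Perm (Fin n)) : ℕ :=
  Finset.univ.sup fun i : Fin n => (i : ℕ) - (σ i : ℕ)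

/-- a n j k : the number of 231-avoiding permutations of {1,…,n} with
j descents and maximum drop at most k. -/
noncomputable def a (n j k : ℕ) : ℕ :=
  Nat.card {σ : Equiv.Perm (Fin n) // avoids231 σ ∧ des σ = j ∧ maxDrop σ ≤ k}

/-- The extended chain $i_0 = 0, i_1, …, i_{k-1}, i_k = j, i_{k+1} = n$ determined by a
tuple $g = (i_1, …, i_{k-1})$ (indexed by `Fin (k-1)`); `V n j k g m` is $i_m$. -/
def V (n j k : ℕ) (g : Fin (k - 1) → ℕ) (m : ℕ) : ℕ :=
  if h : 1 ≤ m ∧ m ≤ k - 1 then g ⟨m - 1, by omega⟩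
  else if m = k then j
  else if m = k + 1 then n
  else 0


open Finset

/-- The extension of a permutation of `Fin n` to `ℕ` by the identity. -/
def extendNat {n : ℕ} (σ : Equiv.Perm (Fin n)) (i : ℕ) : ℕ :=
  if h : i < n then σ ⟨i, h⟩ else i

/-- A function on `ℕ` avoids the pattern 231. -/
def Avoids231Nat (f : ℕ → ℕ) : Prop :=
  ∀ i j l, i < j → j < l → f l < f i → ¬ f i < f j

/-- The number of descents of `f` at positions below `n`. -/
def desBelow (n : ℕ) (f : ℕ → ℕ) : ℕ :=
  ∑ i ∈ range n, if f (i + 1) < f i then 1 else 0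

open scoped Classical in
/-- The 231-avoiding permutations of `{0, …, n - 1}`, extended by the identity to `ℕ`,
whose drops are all smaller than `k`. -/
noncomputable def dropAvoiders (k n : ℕ) : Finset (ℕ → ℕ) :=
  ((univ : Finset (Equiv.Perm (Fin n))).image extendNat).filter
    fun f => Avoids231Nat f ∧ ∀ i < n, i < f i + k

theorem extendNat_injective {n : ℕ} :
    Function.Injective (extendNat : Equiv.Perm (Fin n) → ℕ → ℕ) := by
  intro σ τ h
  ext i
  have := congrFun h i
  simpa [extendNat] using this

theorem exists_extendNat_eq_iff {n : ℕ} {f : ℕ → ℕ} :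
    (∃ σ : Equiv.Perm (Fin n), extendNat σ = f) ↔
      Function.Injective f ∧ ∀ i, n ≤ i → f i = i := by
  constructor
  · rintro ⟨σ, rfl⟩
    refine ⟨fun i j h => ?_, fun i hi => by simp [extendNat, hi]⟩
    unfold extendNat at h
    split_ifs at h with h1 h2 h2
    · simpa using σ.injective (Fin.ext h)
    · have := (σ ⟨i, h1⟩).isLt
      omega
    · have := (σ ⟨j, h2⟩).isLt
      omega
    · exact h
  · rintro ⟨hf, hfix⟩
    have hlt : ∀ i < n, f i < n := by
      intro i hi
      by_contra! h
      have := hf (hfix _ h)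
      omega
    let g : Fin n → Fin n := fun i => ⟨f i, hlt i i.isLt⟩
    have hg : Function.Injective g := fun i j h => Fin.ext (hf (congrArg Fin.val h))
    refine ⟨Equiv.ofBijective g (Finite.injective_iff_bijective.mp hg), ?_⟩
    funext i
    by_cases h : i < n
    · simp [extendNat, h, g]
    · simp [extendNat, h, hfix i (not_lt.mp h)]

theorem mem_dropAvoiders {k n : ℕ} {f : ℕ → ℕ} :
    f ∈ dropAvoiders k n ↔ Function.Injective f ∧ (∀ i, n ≤ i → f i = i) ∧
      Avoids231Nat f ∧ ∀ i < n, i < f i + k := by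
  have := @exists_extendNat_eq_iff n f
  simp only [dropAvoiders, mem_filter, mem_image, mem_univ, true_and, this]
  tauto

theorem lt_of_injective_of_fixed {n : ℕ} {f : ℕ → ℕ} (hf : Function.Injective f)
    (hfix : ∀ i, n ≤ i → f i = i) {i : ℕ} (hi : i < n) : f i < n := by
  by_contra! h
  have := hf (hfix _ h)
  omega

theorem desBelow_le (n : ℕ) (f : ℕ → ℕ) : desBelow n f ≤ n := by
  rw [desBelow, ← card_filter]
  exact (card_filter_le _ _).trans (card_range n).le

theorem avoids231_iff_extendNat {n : ℕ} (σ : Equiv.Perm (Fin n)) :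
    avoids231 σ ↔ Avoids231Nat (extendNat σ) := by
  constructor
  · intro h i j l hij hjl h1 h2
    by_cases hl : l < n
    · refine h ⟨⟨i, by omega⟩, ⟨j, by omega⟩, ⟨l, hl⟩, hij, hjl, ?_, ?_⟩
      · simpa [extendNat, hl, hij.trans (hjl.trans hl)] using h1
      · simpa [extendNat, hjl.trans hl, hij.trans (hjl.trans hl)] using h2
    · obtain ⟨hinj, hfix⟩ := exists_extendNat_eq_iff.mp ⟨σ, rfl⟩
      have hl' := hfix l (not_lt.mp hl)
      by_cases hi : i < n
      · have := lt_of_injective_of_fixed hinj hfix hi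
        omega
      · have := hfix i (not_lt.mp hi)
        omega
  · rintro h ⟨i, j, l, hij, hjl, h1, h2⟩
    refine h i j l hij hjl ?_ ?_ <;> simpa [extendNat]

theorem des_eq_desBelow_extendNat {n : ℕ} (σ : Equiv.Perm (Fin n)) :
    des σ = desBelow n (extendNat σ) := by
  classical
  rw [des, desBelow, ← Fin.sum_univ_eq_sum_range
    (fun i => if extendNat σ (i + 1) < extendNat σ i then 1 else 0), ← card_filter,
    Nat.card_eq_fintype_card, Fintype.card_subtype]
  congr 1
  ext i
  simp only [mem_filter, mem_univ, true_and]
  by_cases h : (i : ℕ) + 1 < n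
  · simp [extendNat, h]
  · have := (σ i).isLt
    simp only [h, IsEmpty.exists_iff, extendNat, dite_false, i.isLt, dite_true, Fin.eta]
    simp only [false_iff, not_lt]
    omega

theorem maxDrop_le_iff_extendNat {n k : ℕ} (σ : Equiv.Perm (Fin n)) :
    maxDrop σ ≤ k ↔ ∀ i < n, i < extendNat σ i + (k + 1) := by
  simp only [maxDrop, Finset.sup_le_iff, mem_univ, true_imp_iff]
  constructor
  · intro h i hi
    have := h ⟨i, hi⟩
    simp only [extendNat, hi, dite_true] at this ⊢
    omega
  · intro h i
    have := h i i.isLt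
    simp only [extendNat, i.isLt, dite_true, Fin.eta] at this
    omega

theorem a_eq_card (n j k : ℕ) :
    a n j k = #{f ∈ dropAvoiders (k + 1) n | desBelow n f = j} := by
  classical
  rw [a, Nat.card_eq_fintype_card, Fintype.card_subtype,
    ← card_image_of_injective _ (extendNat_injective (n := n))]
  congr 1
  ext f
  simp only [dropAvoiders, mem_filter, mem_image, mem_univ, true_and]
  constructor
  · rintro ⟨σ, ⟨h1, h2, h3⟩, rfl⟩
    exact ⟨⟨⟨σ, rfl⟩, (avoids231_iff_extendNat σ).mp h1, (maxDrop_le_iff_extendNat σ).mp h3⟩,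
      (des_eq_desBelow_extendNat σ).symm.trans h2⟩
  · rintro ⟨⟨⟨σ, rfl⟩, h1, h3⟩, h2⟩
    exact ⟨σ, ⟨(avoids231_iff_extendNat σ).mpr h1, (des_eq_desBelow_extendNat σ).trans h2,
      (maxDrop_le_iff_extendNat σ).mpr h3⟩, rfl⟩

/-- The permutation of `{0, …, p + q}` with maximal value at position `p`, whose values to the
left of it are given by `L` and to the right of it by `R`. -/
def glue (p q : ℕ) (L R : ℕ → ℕ) (i : ℕ) : ℕ :=
  if i < p then L i else if i = p then p + q else if i ≤ p + q then p + R (i - p - 1) else i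

theorem glue_of_lt {p q i : ℕ} {L R : ℕ → ℕ} (h : i < p) : glue p q L R i = L i := by
  simp [glue, h]

theorem glue_self {p q : ℕ} {L R : ℕ → ℕ} : glue p q L R p = p + q := by
  simp [glue]

theorem glue_add {p q i : ℕ} {L R : ℕ → ℕ} (hi : i < q) :
    glue p q L R (p + 1 + i) = p + R i := by
  have h1 : ¬ p + 1 + i < p := by omega
  have h2 : p + 1 + i ≠ p := by omega
  have h3 : p + 1 + i - p - 1 = i := by omega
  have h4 : p + 1 + i ≤ p + q := by omega
  simp [glue, h1, h2, h3, h4]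

theorem glue_of_gt {p q i : ℕ} {L R : ℕ → ℕ} (h : p + q < i) : glue p q L R i = i := by
  have h1 : ¬ i < p := by omega
  have h2 : i ≠ p := by omega
  have h3 : ¬ i ≤ p + q := by omega
  simp [glue, h1, h2, h3]

theorem position_cases (p q i : ℕ) :
    i < p ∨ i = p ∨ (∃ i' < q, i = p + 1 + i') ∨ p + q < i := by
  rcases lt_trichotomy i p with h | h | h
  · exact .inl h
  · exact .inr (.inl h)
  · rcases le_or_gt i (p + q) with h' | h'
    · exact .inr (.inr (.inl ⟨i - (p + 1), by omega, by omega⟩))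
    · exact .inr (.inr (.inr h'))

theorem desBelow_glue {k l p q : ℕ} {L R : ℕ → ℕ} (hL : L ∈ dropAvoiders k p)
    (hR : R ∈ dropAvoiders l q) :
    desBelow (p + q + 1) (glue p q L R) =
      desBelow p L + (if q = 0 then 0 else 1) + desBelow q R := by
  obtain ⟨hLi, hLf, -, -⟩ := mem_dropAvoiders.mp hL
  obtain ⟨hRi, hRf, -, -⟩ := mem_dropAvoiders.mp hR
  have hRlt : ∀ i < q, R i < q := fun i hi => lt_of_injective_of_fixed hRi hRf hi
  rw [add_right_comm, desBelow, sum_range_add, sum_range_succ]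
  congr 1
  · congr 1
    · refine sum_congr rfl fun i hi => ?_
      have hi := mem_range.mp hi
      have hLlt := lt_of_injective_of_fixed hLi hLf hi
      rw [glue_of_lt hi]
      rcases lt_or_eq_of_le (Nat.succ_le_of_lt hi) with h | h
      · rw [glue_of_lt h]
      · have h : i + 1 = p := h
        rw [h, glue_self, hLf p le_rfl, if_neg (by omega), if_neg (by omega)]
    · rw [glue_self]
      by_cases hq : q = 0
      · rw [glue_of_gt (by omega), if_neg (by omega), if_pos hq]
      · rw [← add_zero (p + 1), glue_add (Nat.pos_of_ne_zero hq)]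
        simp [hq, hRlt 0 (Nat.pos_of_ne_zero hq)]
  · refine sum_congr rfl fun i hi => ?_
    have hi := mem_range.mp hi
    have := hRlt i hi
    rw [add_assoc (p + 1) i 1, glue_add hi]
    rcases lt_or_eq_of_le (Nat.succ_le_of_lt hi) with h | h
    · rw [glue_add h]
      simp
    · have h : i + 1 = q := h
      rw [glue_of_gt (by omega), if_neg (by omega), h, hRf q le_rfl, if_neg (by omega)]

theorem glue_mem {k p q : ℕ} {L R : ℕ → ℕ} (hL : L ∈ dropAvoiders (k + 1) p)
    (hR : R ∈ dropAvoiders k q) : glue p q L R ∈ dropAvoiders (k + 1) (p + q + 1) := by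
  obtain ⟨hLi, hLf, hLa, hLd⟩ := mem_dropAvoiders.mp hL
  obtain ⟨hRi, hRf, hRa, hRd⟩ := mem_dropAvoiders.mp hR
  have hLlt : ∀ i < p, L i < p := fun i hi => lt_of_injective_of_fixed hLi hLf hi
  have hRlt : ∀ i < q, R i < q := fun i hi => lt_of_injective_of_fixed hRi hRf hi
  refine mem_dropAvoiders.mpr ⟨?_, ?_, ?_, ?_⟩
  · intro i j h
    rcases position_cases p q i with hi | hi | ⟨i, hi, rfl⟩ | hi <;>
    rcases position_cases p q j with hj | hj | ⟨j, hj, rfl⟩ | hj <;>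
    simp only [hi, hj, glue_of_lt, glue_self, glue_add, glue_of_gt] at h <;>
    grind
  · exact fun i hi => glue_of_gt hi
  · intro i j l hij hjl h1 h2
    rcases position_cases p q i with hi | hi | ⟨i, hi, rfl⟩ | hi <;>
    rcases position_cases p q j with hj | hj | ⟨j, hj, rfl⟩ | hj <;>
    rcases position_cases p q l with hl | hl | ⟨l, hl, rfl⟩ | hl <;>
    simp only [hi, hj, hl, glue_of_lt, glue_self, glue_add, glue_of_gt] at h1 h2 <;>
    first | omega | grind [Avoids231Nat]
  · intro i hi'
    rcases position_cases p q i with hi | hi | ⟨i, hi, rfl⟩ | hi <;>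
    simp only [hi, glue_of_lt, glue_self, glue_add, glue_of_gt] <;>
    grind

theorem glue_inj {p q p' q' : ℕ} {L R L' R' : ℕ → ℕ} (hn : p + q = p' + q')
    (hinj : Function.Injective (glue p q L R))
    (hL : ∀ i, p ≤ i → L i = i) (hL' : ∀ i, p' ≤ i → L' i = i)
    (hR : ∀ i, q ≤ i → R i = i) (hR' : ∀ i, q' ≤ i → R' i = i)
    (h : glue p q L R = glue p' q' L' R') : p = p' ∧ q = q' ∧ L = L' ∧ R = R' := by
  have hp : p = p' := by
    apply hinj
    rw [glue_self, h, glue_self, hn]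
  subst hp
  have hq : q = q' := by omega
  subst hq
  refine ⟨rfl, rfl, funext fun i => ?_, funext fun i => ?_⟩
  · rcases lt_or_ge i p with hi | hi
    · simpa [glue_of_lt hi] using congrFun h i
    · rw [hL i hi, hL' i hi]
  · rcases lt_or_ge i q with hi | hi
    · simpa [glue_add hi] using congrFun h (p + 1 + i)
    · rw [hR i hi, hR' i hi]

theorem exists_glue_eq {k n : ℕ} {f : ℕ → ℕ} (hf : f ∈ dropAvoiders (k + 1) (n + 1)) :
    ∃ p q, p + q = n ∧ ∃ L ∈ dropAvoiders (k + 1) p, ∃ R ∈ dropAvoiders k q,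
      glue p q L R = f := by
  obtain ⟨hi, hfix, ha, hd⟩ := mem_dropAvoiders.mp hf
  have hlt : ∀ i < n + 1, f i < n + 1 := fun i h => lt_of_injective_of_fixed hi hfix h
  obtain ⟨p, hp, hpn⟩ : ∃ p < n + 1, f p = n := by
    obtain ⟨σ, rfl⟩ := exists_extendNat_eq_iff.mpr ⟨hi, hfix⟩
    obtain ⟨p, hp⟩ := σ.surjective (Fin.last n)
    exact ⟨p, p.isLt, by simp only [extendNat, p.isLt, dite_true, Fin.eta, hp, Fin.val_last]⟩
  have hne : ∀ i < n + 1, i ≠ p → f i < n := fun i h h' =>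
    lt_of_le_of_ne (Nat.lt_succ_iff.mp (hlt i h)) fun h'' => h' (hi (h''.trans hpn.symm))
  have hlr : ∀ i j, i < p → p < j → j < n + 1 → f i < f j := by
    intro i j hip hpj hj
    by_contra! h
    have h1 : f i ≠ f j := hi.ne (by omega)
    have h2 := hne i (by omega) (by omega)
    exact ha i p j hip hpj (by omega) (by omega)
  have hleft : ∀ i < p, f i < p := by
    intro i hip
    by_contra! h
    have := card_le_card_of_injOn (s := Ioc p n) (t := Ioo (f i) n) f
      (fun j hj => by
        simp only [coe_Ioc, Set.mem_Ioc, coe_Ioo, Set.mem_Ioo] at hj ⊢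
        exact ⟨hlr i j hip hj.1 (by omega), hne j (by omega) (by omega)⟩) hi.injOn
    have h2 := hne i (by omega) (by omega)
    simp only [Nat.card_Ioc, Nat.card_Ioo] at this
    omega
  have hright : ∀ j, p < j → j < n + 1 → p ≤ f j := by
    intro j hpj hj
    by_contra! h
    have := card_le_card_of_injOn (s := range p) (t := range (f j)) f
      (fun i hi => by
        simp only [coe_range, Set.mem_Iio] at hi ⊢
        exact hlr i j hi hpj hj) hi.injOn
    simp only [card_range] at this
    omega
  refine ⟨p, n - p, by omega, fun i => if i < p then f i else i, ?_,
    fun i => if i < n - p then f (p + 1 + i) - p else i, ?_, ?_⟩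
  · refine mem_dropAvoiders.mpr ⟨?_, ?_, ?_, ?_⟩
    · intro i j h
      grind
    · intro i h
      simp [not_lt.mpr h]
    · intro i j l hij hjl h1 h2
      grind [Avoids231Nat]
    · intro i h
      simpa [h] using hd i (by omega)
  · have hr : ∀ i < n - p, ∃ m, f (p + 1 + i) = p + m ∧ m < n - p := fun i h =>
      ⟨f (p + 1 + i) - p, by grind, by grind⟩
    refine mem_dropAvoiders.mpr ⟨?_, ?_, ?_, ?_⟩
    · intro i j h
      have := @hi (p + 1 + i) (p + 1 + j)
      grind
    · intro i h
      simp [not_lt.mpr h]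
    · intro i j l hij hjl h1 h2
      have := ha (p + 1 + i) (p + 1 + j) (p + 1 + l) (by omega) (by omega)
      grind
    · intro i h
      have := hd (p + 1 + i) (by omega)
      obtain ⟨m, hm, -⟩ := hr i h
      simp only [h, if_true]
      omega
  · funext i
    rcases position_cases p (n - p) i with h | h | ⟨i, h, rfl⟩ | h
    · simp [glue_of_lt h, h]
    · rw [h, glue_self, hpn]
      omega
    · rw [glue_add h, if_pos h]
      have := hright (p + 1 + i) (by omega) (by omega)
      omega
    · rw [glue_of_gt h, hfix i (by omega)]

section WeightedCount

variable {R : Type*} [CommRing R]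

/-- The sum of `y ^ (n - des) * z ^ des` over `dropAvoiders k n`. -/
noncomputable def weightSum (y z : R) (k n : ℕ) : R :=
  ∑ f ∈ dropAvoiders k n, y ^ (n - desBelow n f) * z ^ desBelow n f

theorem dropAvoiders_zero_right (k : ℕ) : dropAvoiders k 0 = {id} := by
  ext f
  rw [mem_dropAvoiders, mem_singleton]
  constructor
  · rintro ⟨-, h, -⟩
    exact funext fun i => h i (Nat.zero_le i)
  · rintro rfl
    refine ⟨Function.injective_id, fun _ _ => rfl, fun i j l h1 h2 h3 => ?_, by simp⟩
    simp only [id] at h3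
    omega

theorem weightSum_zero_right (y z : R) (k : ℕ) : weightSum y z k 0 = 1 := by
  simp [weightSum, dropAvoiders_zero_right, desBelow]

theorem weightSum_zero_left (y z : R) (n : ℕ) : weightSum y z 0 (n + 1) = 0 := by
  have : dropAvoiders 0 (n + 1) = ∅ := by
    refine eq_empty_of_forall_notMem fun f hf => ?_
    obtain ⟨hi, hfix, -, hd⟩ := mem_dropAvoiders.mp hf
    have := lt_of_injective_of_fixed hi hfix (Nat.lt_succ_self n)
    have := hd n (Nat.lt_succ_self n)
    omega
  simp [weightSum, this]

theorem weightSum_succ (y z : R) (k n : ℕ) :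
    weightSum y z (k + 1) (n + 1) = ∑ pq ∈ antidiagonal n,
      weightSum y z (k + 1) pq.1 * if pq.2 = 0 then y else z * weightSum y z k pq.2 := by
  have hterm : ∀ pq ∈ antidiagonal n,
      (weightSum y z (k + 1) pq.1 * if pq.2 = 0 then y else z * weightSum y z k pq.2) =
      ∑ LR ∈ dropAvoiders (k + 1) pq.1 ×ˢ dropAvoiders k pq.2,
        y ^ (n + 1 - desBelow (n + 1) (glue pq.1 pq.2 LR.1 LR.2)) *
          z ^ desBelow (n + 1) (glue pq.1 pq.2 LR.1 LR.2) := by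
    rintro ⟨p, q⟩ hpq
    obtain rfl := HasAntidiagonal.mem_antidiagonal.mp hpq
    have hfac : (if q = 0 then y else z * weightSum y z k q) =
        (if q = 0 then y else z) * weightSum y z k q := by
      split_ifs with hq
      · rw [hq, weightSum_zero_right, mul_one]
      · rfl
    dsimp only
    rw [hfac, mul_left_comm, weightSum, weightSum, sum_mul_sum, sum_product, mul_sum]
    refine sum_congr rfl fun L hL => ?_
    rw [mul_sum]
    refine sum_congr rfl fun M hM => ?_
    rw [desBelow_glue hL hM]
    have h1 := desBelow_le p L
    have h2 := desBelow_le q M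
    split_ifs with hq
    · rw [show p + q + 1 - (desBelow p L + 0 + desBelow q M) =
        (p - desBelow p L) + (q - desBelow q M) + 1 by omega]
      ring
    · rw [show p + q + 1 - (desBelow p L + 1 + desBelow q M) =
        (p - desBelow p L) + (q - desBelow q M) by omega]
      ring
  rw [sum_congr rfl hterm, sum_sigma', weightSum]
  symm
  refine sum_bij (fun x _ => glue x.1.1 x.1.2 x.2.1 x.2.2) ?_ ?_ ?_ (fun _ _ => rfl)
  · rintro ⟨⟨p, q⟩, L, M⟩ h
    simp only [mem_sigma, HasAntidiagonal.mem_antidiagonal, mem_product] at h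
    obtain ⟨rfl, hL, hM⟩ := h
    exact glue_mem hL hM
  · rintro ⟨⟨p, q⟩, L, M⟩ h ⟨⟨p', q'⟩, L', M'⟩ h' heq
    simp only [mem_sigma, HasAntidiagonal.mem_antidiagonal, mem_product] at h h'
    obtain ⟨rfl, hL, hM⟩ := h
    obtain ⟨hpq, hL', hM'⟩ := h'
    obtain ⟨rfl, rfl, rfl, rfl⟩ := glue_inj hpq.symm (mem_dropAvoiders.mp (glue_mem hL hM)).1
      (mem_dropAvoiders.mp hL).2.1 (mem_dropAvoiders.mp hL').2.1
      (mem_dropAvoiders.mp hM).2.1 (mem_dropAvoiders.mp hM').2.1 heq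
    rfl
  · intro f hf
    obtain ⟨p, q, hpq, L, hL, M, hM, rfl⟩ := exists_glue_eq hf
    exact ⟨⟨(p, q), L, M⟩, by simp [hpq, hL, hM], rfl⟩

/-- The number of elements of `dropAvoiders k n` with `j` descents. -/
noncomputable def dropCount (k n j : ℕ) : ℕ :=
  #{f ∈ dropAvoiders k n | desBelow n f = j}

theorem dropCount_eq_zero {k n j : ℕ} (h : n < j) : dropCount k n j = 0 := by
  rw [dropCount, card_eq_zero, filter_eq_empty_iff]
  intro f _
  have := desBelow_le n f
  omega

theorem weightSum_eq_sum_dropCount (y z : R) (k n : ℕ) :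
    weightSum y z k n = ∑ i ∈ range (n + 1), (dropCount k n i : R) * (y ^ (n - i) * z ^ i) := by
  rw [weightSum, ← sum_fiberwise_of_maps_to (t := range (n + 1)) (g := desBelow n)
    (fun f _ => mem_range.mpr (Nat.lt_succ_of_le (desBelow_le n f)))]
  refine sum_congr rfl fun i _ => ?_
  rw [dropCount, ← nsmul_eq_mul, ← sum_const]
  refine sum_congr rfl fun f hf => ?_
  rw [(mem_filter.mp hf).2]

open PowerSeries

/-- The generating function of `weightSum` with respect to the length. -/
noncomputable def weightSeries (y z : R) (k : ℕ) : R⟦X⟧ :=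
  PowerSeries.mk (weightSum y z k)

theorem weightSeries_zero (y z : R) : weightSeries y z 0 = 1 := by
  ext n
  rw [weightSeries, coeff_mk]
  cases n with
  | zero => simp [weightSum_zero_right]
  | succ n => simp [weightSum_zero_left, coeff_one]

theorem weightSeries_succ (y z : R) (k : ℕ) :
    weightSeries y z (k + 1) *
      (1 - X * (C y + C z * (weightSeries y z k - 1))) = 1 := by
  have h : weightSeries y z (k + 1) = 1 + X * (weightSeries y z (k + 1) *
      (C y + C z * (weightSeries y z k - 1))) := by
    ext n
    cases n with
    | zero => simp [weightSeries, weightSum_zero_right]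
    | succ n =>
      rw [map_add, coeff_succ_X_mul, coeff_mul, coeff_one, if_neg (Nat.succ_ne_zero n), zero_add,
        weightSeries, coeff_mk, weightSum_succ]
      refine sum_congr rfl fun pq _ => ?_
      rw [coeff_mk]
      congr 1
      rcases pq with ⟨p, q⟩
      cases q with
      | zero => simp [weightSeries, weightSum_zero_right]
      | succ q => simp [weightSeries, coeff_one]
  linear_combination h

/-- Exchange of the two variables of a power series with power series coefficients. -/
noncomputable def swapVars (A : R⟦X⟧⟦X⟧) : R⟦X⟧⟦X⟧ :=
  PowerSeries.mk fun j => PowerSeries.mk fun n => coeff j (coeff n A)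

theorem coeff_coeff_swapVars (A : R⟦X⟧⟦X⟧) (j n : ℕ) :
    coeff n (coeff j (swapVars A)) = coeff j (coeff n A) := by
  simp [swapVars]

theorem swapVars_mul (A B : R⟦X⟧⟦X⟧) : swapVars (A * B) = swapVars A * swapVars B := by
  ext j n
  simp only [coeff_coeff_swapVars, coeff_mul, map_sum]
  rw [sum_comm]

theorem swapVars_add (A B : R⟦X⟧⟦X⟧) : swapVars (A + B) = swapVars A + swapVars B := by
  ext j n
  simp [coeff_coeff_swapVars]

theorem swapVars_sub (A B : R⟦X⟧⟦X⟧) : swapVars (A - B) = swapVars A - swapVars B := by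
  ext j n
  simp [coeff_coeff_swapVars]

theorem swapVars_one : swapVars (1 : R⟦X⟧⟦X⟧) = 1 := by
  ext j n
  rw [coeff_coeff_swapVars, coeff_one, coeff_one]
  split_ifs <;> simp_all [coeff_one]

theorem swapVars_X : swapVars (X : R⟦X⟧⟦X⟧) = C X := by
  ext j n
  rw [coeff_coeff_swapVars, coeff_X, coeff_C]
  split_ifs <;> simp_all [coeff_one, coeff_X]

theorem swapVars_C_X : swapVars (C X : R⟦X⟧⟦X⟧) = X := by
  ext j n
  rw [coeff_coeff_swapVars, coeff_X, coeff_C]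
  split_ifs <;> simp_all [coeff_one, coeff_X]

end WeightedCount

open PowerSeries

/-- The series with coefficient `dropCount k n j` at `X ^ n` inside the coefficient at `X ^ j`. -/
noncomputable def descentSeries (k : ℕ) : ℤ⟦X⟧⟦X⟧ :=
  swapVars (weightSeries 1 X k)

theorem coeff_coeff_descentSeries (k n j : ℕ) :
    coeff n (coeff j (descentSeries k)) = dropCount k n j := by
  rw [descentSeries, coeff_coeff_swapVars, weightSeries, coeff_mk, weightSum_eq_sum_dropCount,
    map_sum]
  have h : ∀ i, coeff j ((dropCount k n i : ℤ⟦X⟧) * (1 ^ (n - i) * X ^ i)) =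
      if i = j then (dropCount k n j : ℤ) else 0 := by
    intro i
    rw [one_pow, one_mul, ← map_natCast (C (R := ℤ)), coeff_C_mul, coeff_X_pow]
    split_ifs <;> simp_all
  rw [sum_congr rfl fun i _ => h i, sum_ite_eq']
  split_ifs with hj
  · rfl
  · rw [dropCount_eq_zero (by simpa using hj), Nat.cast_zero]

theorem descentSeries_zero : descentSeries 0 = 1 := by
  rw [descentSeries, weightSeries_zero, swapVars_one]

theorem descentSeries_succ (k : ℕ) :
    descentSeries (k + 1) * (1 - C X * (1 + X * (descentSeries k - 1))) = 1 := by
  have h := congrArg swapVars (weightSeries_succ (1 : ℤ⟦X⟧) X k)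
  simpa only [descentSeries, swapVars_mul, swapVars_sub, swapVars_add, swapVars_one, swapVars_X, swapVars_C_X,
    map_one] using h

/-- The geometric series `∑ X ^ n`. -/
noncomputable def geomSeries : ℤ⟦X⟧ := PowerSeries.mk 1

theorem geomSeries_mul_one_sub : geomSeries * (1 - X) = 1 :=
  mk_one_mul_one_sub_eq_one ℤ

theorem descentSeries_succ_eq (k : ℕ) :
    descentSeries (k + 1) =
      C geomSeries * weightSeries (X ^ 2 * geomSeries ^ 2) (X * geomSeries ^ 2) k := by
  have hu : (C geomSeries : ℤ⟦X⟧⟦X⟧) * (1 - C X) = 1 := by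
    rw [← map_one (C (R := ℤ⟦X⟧)), ← map_sub, ← map_mul, geomSeries_mul_one_sub]
  induction k with
  | zero =>
    have h := descentSeries_succ 0
    rw [descentSeries_zero, sub_self, mul_zero, add_zero, mul_one] at h
    rw [weightSeries_zero]
    linear_combination C geomSeries * h - descentSeries (0 + 1) * hu
  | succ k ih =>
    have h1 := descentSeries_succ (k + 1)
    have h2 := weightSeries_succ (X ^ 2 * geomSeries ^ 2 : ℤ⟦X⟧) (X * geomSeries ^ 2) k
    rw [ih] at h1
    simp only [map_mul, map_pow] at h2
    set u : ℤ⟦X⟧⟦X⟧ := C geomSeries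
    set x : ℤ⟦X⟧⟦X⟧ := C X
    generalize weightSeries (X ^ 2 * geomSeries ^ 2 : ℤ⟦X⟧) (X * geomSeries ^ 2) k = H at *
    generalize weightSeries (X ^ 2 * geomSeries ^ 2 : ℤ⟦X⟧) (X * geomSeries ^ 2) (k + 1) = G at *
    generalize descentSeries (k + 1 + 1) = F at *
    have key : u * (1 - x * (1 + X * (u * H - 1))) =
        1 - X * (x ^ 2 * u ^ 2 + x * u ^ 2 * (H - 1)) := by
      linear_combination (1 - X * x * u) * hu
    linear_combination (u * G) * h1 - F * h2 - F * G * key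

theorem coeff_geomSeries_pow (m d : ℕ) :
    coeff m (geomSeries ^ (d + 1)) = ((d + m).choose d : ℤ) := by
  rw [geomSeries, mk_one_pow_eq_mk_choose_add, coeff_mk]

theorem dropCount_succ_succ (k n j : ℕ) :
    dropCount (k + 2) n j =
      ∑ i ∈ range (j + 1), (n + i).choose (2 * j) * dropCount (k + 1) j i := by
  have h := congrArg (fun A => coeff n (coeff j A)) (descentSeries_succ_eq (k + 1))
  simp only [coeff_coeff_descentSeries, coeff_C_mul, weightSeries, coeff_mk,
    weightSum_eq_sum_dropCount, mul_sum, map_sum] at h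
  zify
  rw [h]
  refine sum_congr rfl fun i hi => ?_
  have hi := mem_range.mp hi
  have hmon : geomSeries * ((dropCount (k + 1) j i : ℤ⟦X⟧) *
      ((X ^ 2 * geomSeries ^ 2) ^ (j - i) * (X * geomSeries ^ 2) ^ i)) =
      C (dropCount (k + 1) j i : ℤ) * (geomSeries ^ (2 * j + 1) * X ^ (2 * j - i)) := by
    obtain ⟨d, rfl⟩ : ∃ d, j = i + d := ⟨j - i, by omega⟩
    rw [show i + d - i = d by omega, show 2 * (i + d) - i = i + 2 * d by omega, map_natCast]
    ring
  rw [hmon, coeff_C_mul, coeff_mul_X_pow', mul_comm]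
  split_ifs with hn
  · rw [coeff_geomSeries_pow, show 2 * j + (n - (2 * j - i)) = n + i by omega]
  · rw [Nat.choose_eq_zero_of_lt (by omega), Nat.cast_zero]

theorem dropCount_one (n j : ℕ) : dropCount 1 n j = if j = 0 then 1 else 0 := by
  have h := congrArg (fun A => coeff n (coeff j A)) (descentSeries_succ_eq 0)
  simp only [coeff_coeff_descentSeries, weightSeries_zero, mul_one, coeff_C] at h
  split_ifs at h ⊢ <;> zify <;> simpa [geomSeries] using h

theorem dropCount_two (n j : ℕ) : dropCount 2 n j = n.choose (2 * j) := by
  rw [dropCount_succ_succ 0, sum_eq_single 0] <;> simp +contextual [dropCount_one]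

/-- The product in `a_closed_form`. -/
def chainProd (n j k : ℕ) (g : Fin (k - 1) → ℕ) : ℕ :=
  ∏ m ∈ range k, (V n j k g (m + 2) + V n j k g m).choose (2 * V n j k g (m + 1))

theorem V_top (n j k : ℕ) (g : Fin (k - 1) → ℕ) : V n j k g (k + 1) = n := by
  simp [V]

theorem V_self {n j k : ℕ} (hk : 1 ≤ k) (g : Fin (k - 1) → ℕ) : V n j k g k = j := by
  have h : ¬ (1 ≤ k ∧ k ≤ k - 1) := by omega
  simp only [V, h, dite_false, if_true]

theorem V_zero {n j k : ℕ} (hk : 1 ≤ k) (g : Fin (k - 1) → ℕ) : V n j k g 0 = 0 := by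
  have h : 0 ≠ k := by omega
  simp [V, h]

theorem V_snoc {n j k m : ℕ} (g : Fin (k + 1) → ℕ) (i : ℕ) (hm : m ≤ k + 3) :
    V n j (k + 3) (Fin.snoc g i : Fin (k + 2) → ℕ) m = V j i (k + 2) g m := by
  rcases Nat.eq_zero_or_pos m with h0 | h0
  · rw [h0, V_zero (by omega), V_zero (by omega)]
  rcases eq_or_lt_of_le hm with h | h
  · rw [h, V_self (by omega), V_top]
  have h1 : 1 ≤ m ∧ m ≤ k + 3 - 1 := by omega
  rcases eq_or_lt_of_le (Nat.lt_succ_iff.mp h) with h2 | h2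
  · subst h2
    rw [V_self (by omega), V, dif_pos h1]
    exact Fin.snoc_last (α := fun _ => ℕ) i g
  · have h3 : 1 ≤ m ∧ m ≤ k + 2 - 1 := by omega
    rw [V, dif_pos h1, V, dif_pos h3]
    exact Fin.snoc_castSucc (α := fun _ => ℕ) i g ⟨m - 1, by omega⟩

theorem chainProd_snoc (n j k : ℕ) (g : Fin (k + 1) → ℕ) (i : ℕ) :
    chainProd n j (k + 3) (Fin.snoc g i : Fin (k + 2) → ℕ) =
      (n + i).choose (2 * j) * chainProd j i (k + 2) g := by
  rw [chainProd, prod_range_succ, mul_comm, V_top, V_self (by omega),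
    V_snoc g i (by omega : k + 2 ≤ k + 3), V_self (by omega), chainProd]
  congr 1
  refine prod_congr rfl fun m hm => ?_
  have hm := mem_range.mp hm
  rw [V_snoc g i (by omega), V_snoc g i (by omega), V_snoc g i (by omega)]

theorem sum_piFinset_snoc {k : ℕ} (s : Finset ℕ) (F : (Fin (k + 1) → ℕ) → ℕ) :
    ∑ g ∈ Fintype.piFinset (fun _ : Fin (k + 1) => s), F g =
      ∑ i ∈ s, ∑ g ∈ Fintype.piFinset (fun _ : Fin k => s), F (Fin.snoc g i) := by
  rw [← sum_product']
  refine sum_bij' (fun g _ => (g (Fin.last k), Fin.init g)) (fun x _ => Fin.snoc x.2 x.1)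
    ?_ ?_ ?_ ?_ ?_
  · intro g hg
    rw [Fintype.mem_piFinset] at hg
    exact mem_product.mpr ⟨hg _, Fintype.mem_piFinset.mpr fun i => hg _⟩
  · intro x hx
    obtain ⟨h1, h2⟩ := mem_product.mp hx
    rw [Fintype.mem_piFinset] at h2 ⊢
    intro i
    refine Fin.lastCases ?_ (fun i => ?_) i
    · simpa using h1
    · simpa using h2 i
  · intro g _
    simp
  · intro x _
    simp
  · intro g _
    simp

theorem sum_chainProd (k : ℕ) : ∀ n j B : ℕ, j ≤ B →
    ∑ g ∈ Fintype.piFinset (fun _ : Fin (k + 1) => range (B + 1)), chainProd n j (k + 2) g =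
      dropCount (k + 3) n j := by
  induction k with
  | zero =>
    intro n j B hj
    rw [sum_piFinset_snoc, dropCount_succ_succ 1]
    have h : ∀ i (g : Fin 0 → ℕ), chainProd n j 2 (Fin.snoc g i : Fin 1 → ℕ) =
        (n + i).choose (2 * j) * dropCount 2 j i := by
      intro i g
      have hV : V n j 2 (Fin.snoc g i : Fin 1 → ℕ) 1 = i := by
        simp [V, Fin.snoc]
      rw [chainProd, prod_range_succ, prod_range_one, V_top, V_self (by omega),
        V_zero (by omega), zero_add, hV, dropCount_two, add_zero, mul_comm]
    simp only [h, sum_const, Fintype.card_piFinset, univ_eq_empty, prod_empty, one_smul]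
    refine (sum_subset (range_mono (by omega)) fun i _ hi => ?_).symm
    rw [dropCount_eq_zero (by simpa using hi), mul_zero]
  | succ k ih =>
    intro n j B hj
    rw [sum_piFinset_snoc, dropCount_succ_succ (k + 2)]
    have h : ∀ i ∈ range (B + 1),
        ∑ g ∈ Fintype.piFinset (fun _ : Fin (k + 1) => range (B + 1)),
          chainProd n j (k + 3) (Fin.snoc g i : Fin (k + 2) → ℕ) =
        (n + i).choose (2 * j) * dropCount (k + 3) j i := by
      intro i hi
      rw [← ih j i B (Nat.lt_succ_iff.mp (mem_range.mp hi)), mul_sum]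
      exact sum_congr rfl fun g _ => chainProd_snoc n j k g i
    refine (sum_congr rfl h).trans ?_
    refine (sum_subset (range_mono (by omega)) fun i _ hi => ?_).symm
    rw [dropCount_eq_zero (by simpa using hi), mul_zero]

theorem V_le_succ_of_chainProd_ne_zero {n j k : ℕ} (hk : 1 ≤ k) {g : Fin (k - 1) → ℕ}
    (h : chainProd n j k g ≠ 0) {m : ℕ} (hm : m ≤ k) : V n j k g m ≤ V n j k g (m + 1) := by
  induction m with
  | zero =>
    rw [V_zero hk]
    exact Nat.zero_le _
  | succ m ih =>
    have h1 := prod_ne_zero_iff.mp h m (mem_range.mpr hm)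
    rw [Nat.choose_ne_zero_iff] at h1
    have h1 : 2 * V n j k g (m + 1) ≤ V n j k g (m + 1 + 1) + V n j k g m := h1
    have := ih (by omega)
    omega

open scoped Classical in
theorem a_closed_form (n j k : ℕ) (hn : 1 ≤ n) (hk : 2 ≤ k) :
    a n j k =
      ∑ g ∈ (Fintype.piFinset fun _ : Fin (k - 1) => Finset.range (j + 1)).filter
          (fun g => ∀ m ∈ Finset.Icc 1 (k - 2), V n j k g m ≤ V n j k g (m + 1)),
        ∏ m ∈ Finset.range k,
          (V n j k g (m + 2) + V n j k g m).choose (2 * V n j k g (m + 1)) := by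
  obtain ⟨k, rfl⟩ : ∃ k', k = k' + 2 := ⟨k - 2, by omega⟩
  have h : a n j (k + 2) = dropCount (k + 3) n j := by
    rw [a_eq_card, dropCount]
  rw [h, ← sum_chainProd k n j j le_rfl]
  refine (@Finset.sum_filter_of_ne _ _ _ _ _ _ (_) fun g _ hg m hm => ?_).symm
  have := Finset.mem_Icc.mp hm
  exact V_le_succ_of_chainProd_ne_zero (by omega) hg (by omega)
end

section
/- For all n ≥ j ≥ 2, the Narayana numbers N(n, j) = (1/n)·C(n, j)·C(n, j−1) satisfy the recurrence N(n, j) = Σ_{i=1}^{j−1} N(j−1, i) · C(n+i−1, 2j−2). -/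
/-- The Narayana number $N(n,j) = \frac{1}{n}\binom{n}{j}\binom{n}{j-1}$. -/
noncomputable def narayana (n j : ℕ) : ℚ :=
  (n.choose j : ℚ) * (n.choose (j - 1) : ℚ) / n

/-- Vandermonde's identity, summed over a range that covers the support of `a.choose`. -/
theorem sum_range_choose_mul_choose {a k : ℕ} (b : ℕ) {r : ℕ} (har : a < r) (hrk : r ≤ k + 1) :
    ∑ t ∈ Finset.range r, a.choose t * b.choose (k - t) = (a + b).choose k := by
  rw [Nat.add_choose_eq, Finset.Nat.sum_antidiagonal_eq_sum_range_succ_mk]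
  refine Finset.sum_subset (Finset.range_mono hrk) fun t _ ht => ?_
  rw [Nat.choose_eq_zero_of_lt (by simp at ht; omega), zero_mul]

theorem sum_range_choose_mul_choose_mul_choose {p t : ℕ} (htp : t ≤ p) :
    ∑ k ∈ Finset.range (p + 1), p.choose k * (p + 2).choose (k + 1) * k.choose t =
      p.choose t * (2 * (p + 1) - t).choose (p + 1) := by
  obtain ⟨u, rfl⟩ := Nat.exists_eq_add_of_le htp
  rw [add_assoc t u 1, Finset.sum_range_add, Finset.sum_eq_zero, zero_add]
  · rw [show 2 * (t + (u + 1)) - t = u + (t + u + 2) by omega,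
      Nat.choose_symm_of_eq_add (a := t + (u + 1)) (b := u + 1)
        (show u + (t + u + 2) = _ by omega),
      ← sum_range_choose_mul_choose (t + u + 2) (Nat.lt_succ_self u) (by omega), Finset.mul_sum]
    refine Finset.sum_congr rfl fun l hl => ?_
    have hl' : l ≤ u := by simp at hl; omega
    have h := Nat.choose_mul (n := t + u) (k := t + l) (s := t) (by omega)
    rw [Nat.add_sub_cancel_left, Nat.add_sub_cancel_left] at h
    rw [mul_right_comm, h, mul_assoc,
      Nat.choose_symm_of_eq_add (n := t + u + 2) (a := t + l + 1) (b := u + 1 - l) (by omega)]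
  · intro k hk
    rw [Nat.choose_eq_zero_of_lt (Finset.mem_range.mp hk), mul_zero]

/-- The case of Nanjundiah's identity expanding a product of two adjacent binomials. -/
theorem choose_mul_choose_pred_eq_sum {n p : ℕ} (hn : p + 1 ≤ n) :
    n.choose (p + 1) * (n - 1).choose (p + 1) =
      ∑ k ∈ Finset.range (p + 1),
        p.choose k * (p + 2).choose (k + 1) * (n + k).choose (2 * (p + 1)) := by
  symm
  calc
    _ = ∑ k ∈ Finset.range (p + 1), ∑ t ∈ Finset.range (p + 1),
        p.choose k * (p + 2).choose (k + 1) * k.choose t * n.choose (2 * (p + 1) - t) := by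
      refine Finset.sum_congr rfl fun k hk => ?_
      rw [add_comm n k, ← sum_range_choose_mul_choose n (Finset.mem_range.mp hk) (by omega),
        Finset.mul_sum]
      simp only [mul_assoc]
    _ = ∑ t ∈ Finset.range (p + 1),
        n.choose (p + 1) * (p.choose t * (n - (p + 1)).choose (p + 1 - t)) := by
      rw [Finset.sum_comm]
      refine Finset.sum_congr rfl fun t ht => ?_
      have htp : t ≤ p := by simp at ht; omega
      have h := Nat.choose_mul (n := n) (k := 2 * (p + 1) - t) (s := p + 1) (by omega)
      rw [show 2 * (p + 1) - t - (p + 1) = p + 1 - t by omega] at h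
      rw [← Finset.sum_mul, sum_range_choose_mul_choose_mul_choose htp, mul_assoc,
        mul_comm (Nat.choose _ (p + 1)), h, mul_left_comm]
    _ = _ := by
      rw [← Finset.mul_sum, sum_range_choose_mul_choose _ (Nat.lt_succ_self p) (by omega),
        show p + (n - (p + 1)) = n - 1 by omega]

theorem narayana_succ_succ (n m : ℕ) :
    narayana (n + 1) (m + 1) = ((n + 1).choose m * n.choose m : ℕ) / ((m : ℚ) + 1) := by
  have h : ((n : ℚ) + 1) * n.choose m = (n + 1).choose (m + 1) * ((m : ℚ) + 1) := by
    exact_mod_cast Nat.add_one_mul_choose_eq n m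
  rw [narayana, Nat.add_sub_cancel]
  push_cast
  field_simp
  linear_combination -((n + 1).choose m : ℚ) * h

theorem narayana_succ_succ_eq_choose_mul_choose_succ (p k : ℕ) :
    narayana (p + 1) (k + 1) =
      (p.choose k * (p + 2).choose (k + 1) : ℕ) / ((p : ℚ) + 2) := by
  have h : ((p : ℚ) + 2) * (p + 1).choose k = (p + 2).choose (k + 1) * ((k : ℚ) + 1) := by
    exact_mod_cast Nat.add_one_mul_choose_eq (p + 1) k
  rw [narayana_succ_succ]
  push_cast
  field_simp
  linear_combination (p.choose k : ℚ) * h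

theorem narayana_recurrence (n j : ℕ) (hj : 2 ≤ j) (hjn : j ≤ n) :
    narayana n j =
      ∑ i ∈ Finset.Icc 1 (j - 1), narayana (j - 1) i * ((n + i - 1).choose (2 * j - 2) : ℚ) := by
  obtain ⟨p, rfl⟩ := Nat.exists_eq_add_of_le' hj
  obtain ⟨q, rfl⟩ := Nat.exists_eq_add_of_le' (show 1 ≤ n by omega)
  have h := choose_mul_choose_pred_eq_sum (n := q + 1) (p := p) (by omega)
  rw [Nat.add_sub_cancel] at h
  rw [narayana_succ_succ q (p + 1), h, Nat.cast_sum, Finset.sum_div,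
    show p + 2 - 1 = p + 1 by omega, ← Finset.Ico_add_one_right_eq_Icc,
    Finset.sum_Ico_eq_sum_range, Nat.add_sub_cancel]
  refine Finset.sum_congr rfl fun k _ => ?_
  rw [add_comm 1 k, narayana_succ_succ_eq_choose_mul_choose_succ,
    show q + 1 + (k + 1) - 1 = q + 1 + k by omega, show 2 * (p + 2) - 2 = 2 * (p + 1) by omega]
  push_cast
  ring
end
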